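/- (Crude bound on the sum of unweighted bonuses; deterministic core of Lemma E.6.) Let Z be a set, L ≥ 1, λ ≥ 1, C ≥ 1, ε_b ≥ 0, let F be a set of functions Z → [0, L], let T be a positive integer, let z_1, …, z_T ∈ Z, let S ⊆ {1, …, T}, and let 0 ≤ β_t ≤ β for t ∈ S. Suppose for each t ∈ S the function b_t : Z → [0, ∞) satisfies b_t(z_t) ≤ C ( D_F(z_t; z_{[t−1]}, 𝟙_{[t−1]}) · √(β_t² + λ) + ε_b · β_t ). Set 𝔡 := Σ_{t=1}^T min(1, D_F²(z_t; z_{[t−1]}, 𝟙_{[t−1]})). Then Σ_{t ∈ S} min(1 + L, b_t(z_t)) ≤ (1 + L) C √(β² + λ) ( 𝔡 + √( |S| · 𝔡 ) ) + C |S| ε_b β. -/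

import Mathlib

open Finset

/-- The (squared) uncertainty quantity `D_F²(z; z_{[n]}, σ_{[n]})`; the prefix consists
of the first `n` points `zs 0, …, zs (n-1)` with weights `w 0, …, w (n-1)`. -/
noncomputable def D2 {Z : Type*} (F : Set (Z → ℝ)) (lam : ℝ)
    (z : Z) (n : ℕ) (zs : ℕ → Z) (w : ℕ → ℝ) : ℝ :=
  sSup {r : ℝ | ∃ f₁ ∈ F, ∃ f₂ ∈ F,
    r = (f₁ z - f₂ z) ^ 2 /
      ((∑ s ∈ Finset.range n, (f₁ (zs s) - f₂ (zs s)) ^ 2 / w s ^ 2) + lam)}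

theorem D2_nonneg {Z : Type*} (F : Set (Z → ℝ)) {lam : ℝ} (hlam : 0 ≤ lam)
    (z : Z) (n : ℕ) (zs : ℕ → Z) (w : ℕ → ℝ) : 0 ≤ D2 F lam z n zs w := by
  refine Real.sSup_nonneg ?_
  rintro r ⟨f₁, -, f₂, -, rfl⟩
  positivity

theorem sum_sqrt_le_sqrt_card_mul_sum {ι : Type*} (S : Finset ι) {x : ι → ℝ}
    (hx : ∀ i ∈ S, 0 ≤ x i) :
    ∑ i ∈ S, Real.sqrt (x i) ≤ Real.sqrt ((S.card : ℝ) * ∑ i ∈ S, x i) := by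
  refine Real.le_sqrt_of_sq_le (sq_sum_le_card_mul_sum_sq.trans_eq ?_)
  rw [Finset.sum_congr rfl fun i hi => Real.sq_sqrt (hx i hi)]

/-- Truncating both sides: a bound by `√d` becomes one by `x + √x` with `x = min 1 d`. -/
theorem min_le_of_le_sqrt_mul_add {L K e d y : ℝ} (hL : 0 ≤ L) (hK : 1 ≤ K) (he : 0 ≤ e)
    (hd : 0 ≤ d) (hy : y ≤ Real.sqrt d * K + e) :
    min (1 + L) y ≤ (1 + L) * K * (min 1 d + Real.sqrt (min 1 d)) + e := by
  rcases le_total d 1 with h | h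
  · rw [min_eq_right h]
    refine (min_le_right _ _).trans (hy.trans ?_)
    have h₁ : 0 ≤ Real.sqrt d * K := by positivity
    have h₂ : 0 ≤ (1 + L) * K * d := by positivity
    nlinarith [mul_nonneg hL h₁]
  · rw [min_eq_left h, Real.sqrt_one]
    refine (min_le_left _ _).trans ?_
    nlinarith [mul_nonneg (show (0 : ℝ) ≤ 1 + L by linarith) (sub_nonneg.2 hK)]

/-- **Crude bound on the sum of unweighted bonuses (deterministic core of Lemma E.6).**
Points are indexed `z_0, …, z_{T-1}`, with prefix `z_{[t-1]}` the first `t` points. If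
each bonus satisfies `b_t(z_t) ≤ C (D_F(z_t; z_{[t-1]}, 𝟙)·√(β_t² + λ) + ε_b β_t)` and
`𝔡 := ∑_{t<T} min(1, D_F²(z_t; z_{[t-1]}, 𝟙))`, then
`∑_{t∈S} min(1+L, b_t(z_t)) ≤ (1+L) C √(β²+λ) (𝔡 + √(|S| 𝔡)) + C |S| ε_b β`. -/
theorem stmt16 {Z : Type*} (L lam C εb : ℝ)
    (hL : 1 ≤ L) (hlam : 1 ≤ lam) (hC : 1 ≤ C) (hεb : 0 ≤ εb)
    (F : Set (Z → ℝ)) (hFrange : ∀ f ∈ F, ∀ x, f x ∈ Set.Icc 0 L)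
    (T : ℕ) (hT : 0 < T) (z : ℕ → Z) (S : Finset ℕ) (hS : S ⊆ Finset.range T)
    (β : ℕ → ℝ) (βmax : ℝ) (hβ : ∀ t ∈ S, 0 ≤ β t ∧ β t ≤ βmax)
    (b : ℕ → Z → ℝ) (hbnonneg : ∀ t ∈ S, ∀ x, 0 ≤ b t x)
    (hb : ∀ t ∈ S, b t (z t) ≤
      C * (Real.sqrt (D2 F lam (z t) t z fun _ => 1) * Real.sqrt (β t ^ 2 + lam)
        + εb * β t))
    (dfrak : ℝ)
    (hdfrak : dfrak = ∑ t ∈ Finset.range T, min 1 (D2 F lam (z t) t z fun _ => 1)) :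
    ∑ t ∈ S, min (1 + L) (b t (z t))
      ≤ (1 + L) * C * Real.sqrt (βmax ^ 2 + lam) *
          (dfrak + Real.sqrt ((S.card : ℝ) * dfrak))
        + C * (S.card : ℝ) * εb * βmax := by
  have hd : ∀ t, 0 ≤ D2 F lam (z t) t z fun _ => 1 :=
    fun t => D2_nonneg F (zero_le_one.trans hlam) _ _ _ _
  set x : ℕ → ℝ := fun t => min 1 (D2 F lam (z t) t z fun _ => 1) with hxdef
  have hx : ∀ t, 0 ≤ x t := fun t => le_min zero_le_one (hd t)
  set K := C * Real.sqrt (βmax ^ 2 + lam) with hKdef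
  have hK : 1 ≤ K :=
    one_le_mul_of_one_le_of_one_le hC (Real.one_le_sqrt.2 (by nlinarith [sq_nonneg βmax]))
  have hterm : ∀ t ∈ S, min (1 + L) (b t (z t)) ≤
      (1 + L) * K * (x t + Real.sqrt (x t)) + C * εb * βmax := by
    intro t ht
    obtain ⟨h0, h1⟩ := hβ t ht
    have hβmax : 0 ≤ βmax := h0.trans h1
    refine min_le_of_le_sqrt_mul_add (by linarith) hK (by positivity) (hd t) ?_
    calc b t (z t) ≤ C * (Real.sqrt (D2 F lam (z t) t z fun _ => 1)
          * Real.sqrt (β t ^ 2 + lam) + εb * β t) := hb t ht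
      _ ≤ C * (Real.sqrt (D2 F lam (z t) t z fun _ => 1)
          * Real.sqrt (βmax ^ 2 + lam) + εb * βmax) := by gcongr
      _ = _ := by rw [hKdef]; ring
  have hsum : ∑ t ∈ S, x t ≤ dfrak :=
    hdfrak ▸ Finset.sum_le_sum_of_subset_of_nonneg hS fun t _ _ => hx t
  have hsqrt : ∑ t ∈ S, Real.sqrt (x t) ≤ Real.sqrt ((S.card : ℝ) * dfrak) :=
    (sum_sqrt_le_sqrt_card_mul_sum S fun t _ => hx t).trans (Real.sqrt_le_sqrt (by gcongr))
  calc ∑ t ∈ S, min (1 + L) (b t (z t))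
      ≤ ∑ t ∈ S, ((1 + L) * K * (x t + Real.sqrt (x t)) + C * εb * βmax) :=
        Finset.sum_le_sum hterm
    _ = (1 + L) * K * (∑ t ∈ S, x t + ∑ t ∈ S, Real.sqrt (x t))
          + C * (S.card : ℝ) * εb * βmax := by
        rw [Finset.sum_add_distrib, ← Finset.mul_sum, Finset.sum_add_distrib,
          Finset.sum_const, nsmul_eq_mul]
        ring
    _ ≤ (1 + L) * K * (dfrak + Real.sqrt ((S.card : ℝ) * dfrak))
          + C * (S.card : ℝ) * εb * βmax := by gcongr
    _ = _ := by rw [hKdef]; ring
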